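/- Let n, m ≥ 0 be integers with (n,m) ≠ (0,1), and let T_2 denote the family of partial 2-trees. If T is a minimal (n,m)-universal bound of T_2 on exactly (2n+m)^2 + (2n+m) + 1 vertices, then every vertex of T has exactly (2n+m)+1 many α-neighbors for every adjacency type α ∈ {1,…,2n+m}; in particular the underlying graph of T is complete. -/

import Mathlib

open SimpleGraph

/-- The involution pairing the label of an arc with the label of the corresponding
reverse arc: for `1 ≤ k ≤ 2n`, the labels `2i` (arc of type `i`) and `2i-1`
(reverse arc of type `i`) are swapped; edge labels `2n+1, …, 2n+m` are fixed. -/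
def conjLab (n k : ℕ) : ℕ :=
  if k ≤ 2 * n then (if k % 2 = 0 then k - 1 else k + 1) else k

/-- An `(n,m)`-graph: a simple underlying graph together with a labelling of each
ordered pair of adjacent vertices by a number in `{1, …, 2n+m}` (`lab u v = α`
means that `v` is an `α`-neighbor of `u`), compatible with reversal. -/
structure NMGraph (n m : ℕ) (V : Type) where
  und : SimpleGraph V
  lab : V → V → ℕ
  lab_mem : ∀ u v, und.Adj u v → 1 ≤ lab u v ∧ lab u v ≤ 2 * n + m
  lab_conj : ∀ u v, und.Adj u v → lab v u = conjLab n (lab u v)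

/-- `N^α(u)`, the set of `α`-neighbors of `u`. -/
def NMGraph.nbr {n m : ℕ} {V : Type} (G : NMGraph n m V) (α : ℕ) (u : V) : Set V :=
  {v | G.und.Adj u v ∧ G.lab u v = α}

/-- `G → H`: existence of a homomorphism of `(n,m)`-graphs, i.e. a vertex map
preserving adjacency together with the type (and direction) of every arc/edge. -/
def NMGraph.HomTo {n m : ℕ} {V W : Type} (G : NMGraph n m V) (H : NMGraph n m W) : Prop :=
  ∃ f : V → W, ∀ u v, G.und.Adj u v →
    H.und.Adj (f u) (f v) ∧ H.lab (f u) (f v) = G.lab u v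

/-- The `(n,m)`-chromatic number of an `(n,m)`-graph: the least number of vertices
of a target of a homomorphism. -/
noncomputable def nmChrom (n m : ℕ) {V : Type} (G : NMGraph n m V) : ℕ :=
  sInf {t | ∃ H : NMGraph n m (Fin t), G.HomTo H}

/-- The 2-tree extension: add a new vertex adjacent to both endpoints of the edge `uv`. -/
def addVertex {N : ℕ} (G : SimpleGraph (Fin N)) (u v : Fin N) : SimpleGraph (Fin (N + 1)) :=
  SimpleGraph.fromRel (fun a b =>
    (∃ a' b', a = Fin.castSucc a' ∧ b = Fin.castSucc b' ∧ G.Adj a' b') ∨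
    (a = Fin.last N ∧ (b = Fin.castSucc u ∨ b = Fin.castSucc v)))

/-- 2-trees: `K₂` is a 2-tree, and adding a new vertex adjacent to the two endpoints
of an existing edge of a 2-tree yields a 2-tree. -/
inductive Is2Tree : (N : ℕ) → SimpleGraph (Fin N) → Prop
  | base : Is2Tree 2 ⊤
  | extend {N : ℕ} {G : SimpleGraph (Fin N)} (u v : Fin N) (huv : G.Adj u v)
      (h : Is2Tree N G) : Is2Tree (N + 1) (addVertex G u v)

/-- A partial 2-tree: a graph isomorphic to a subgraph of some 2-tree. -/
def IsPartial2Tree {V : Type} (G : SimpleGraph V) : Prop :=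
  ∃ (N : ℕ) (T : SimpleGraph (Fin N)) (f : G →g T), Is2Tree N T ∧ Function.Injective f

/-- The subgraph of an `(n,m)`-graph `T` determined by a vertex set `s` and a
spanning collection of edges `H ≤ T.und`, keeping the inherited labels. -/
def NMGraph.restrict {n m : ℕ} {W : Type} (T : NMGraph n m W) (s : Set W)
    (H : SimpleGraph W) (hle : H ≤ T.und) : NMGraph n m {x : W // x ∈ s} where
  und := SimpleGraph.comap Subtype.val H
  lab := fun u v => T.lab u.1 v.1
  lab_mem := fun u v h => T.lab_mem u.1 v.1 (hle h)
  lab_conj := fun u v h => T.lab_conj u.1 v.1 (hle h)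

/-- `T` is an `(n,m)`-universal bound of the family `T₂` of partial 2-trees. -/
def IsUnivBoundT2 (n m : ℕ) {W : Type} (T : NMGraph n m W) : Prop :=
  ∀ (N : ℕ) (G : NMGraph n m (Fin N)), IsPartial2Tree G.und → G.HomTo T

/-- `T` is a minimal `(n,m)`-universal bound of `T₂`: it is a universal bound and
no proper subgraph of `T` is one. -/
def IsMinUnivBoundT2 (n m : ℕ) {W : Type} (T : NMGraph n m W) : Prop :=
  IsUnivBoundT2 n m T ∧
  ∀ (s : Set W) (H : SimpleGraph W) (hle : H ≤ T.und),
    (s ≠ Set.univ ∨ H ≠ T.und) → ¬ IsUnivBoundT2 n m (T.restrict s H hle)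

lemma conjLab_conjLab {n k : ℕ} (hk : 1 ≤ k) : conjLab n (conjLab n k) = k := by
  unfold conjLab
  split_ifs <;> omega

lemma conjLab_mem {n m k : ℕ} (h : 1 ≤ k ∧ k ≤ 2 * n + m) :
    1 ≤ conjLab n k ∧ conjLab n k ≤ 2 * n + m := by
  unfold conjLab
  split_ifs <;> omega

section AddVertex

variable {N : ℕ} (G : SimpleGraph (Fin N)) (u v : Fin N)

@[simp] lemma addVertex_adj_castSucc (a b : Fin N) :
    (addVertex G u v).Adj a.castSucc b.castSucc ↔ G.Adj a b := by
  simp only [addVertex, SimpleGraph.fromRel_adj, ne_eq, Fin.castSucc_inj,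
    (Fin.castSucc_lt_last _).ne, false_and, or_false]
  constructor
  · rintro ⟨_, ⟨_, _, rfl, rfl, h⟩ | ⟨_, _, rfl, rfl, h⟩⟩
    exacts [h, h.symm]
  · exact fun h => ⟨h.ne, Or.inl ⟨a, b, rfl, rfl, h⟩⟩

@[simp] lemma addVertex_adj_last_castSucc (a : Fin N) :
    (addVertex G u v).Adj (Fin.last N) a.castSucc ↔ a = u ∨ a = v := by
  simp [addVertex, SimpleGraph.fromRel_adj, (Fin.castSucc_lt_last _).ne,
    (Fin.castSucc_lt_last _).ne']

@[simp] lemma addVertex_adj_castSucc_last (a : Fin N) :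
    (addVertex G u v).Adj a.castSucc (Fin.last N) ↔ a = u ∨ a = v := by
  rw [SimpleGraph.adj_comm, addVertex_adj_last_castSucc]

end AddVertex

lemma Is2Tree.exists_adj {N : ℕ} {G : SimpleGraph (Fin N)} (h : Is2Tree N G) (a : Fin N) :
    ∃ b, G.Adj a b := by
  induction h with
  | base => exact exists_ne a |>.imp fun b hb => by simpa using hb.symm
  | extend u v huv h ih =>
    induction a using Fin.lastCases with
    | last => exact ⟨u.castSucc, by simp⟩
    | cast a =>
      obtain ⟨b, hb⟩ := ih a
      exact ⟨b.castSucc, by simpa using hb⟩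

lemma Is2Tree.isPartial2Tree {N : ℕ} {G : SimpleGraph (Fin N)} (h : Is2Tree N G) :
    IsPartial2Tree G :=
  ⟨N, G, SimpleGraph.Hom.id, h, Function.injective_id⟩

namespace NMGraph

variable {n m : ℕ}

/-- A vertex map preserving adjacency and labels. -/
def IsHom {V W : Type} (G : NMGraph n m V) (H : NMGraph n m W) (f : V → W) : Prop :=
  ∀ u v, G.und.Adj u v → H.und.Adj (f u) (f v) ∧ H.lab (f u) (f v) = G.lab u v

lemma IsHom.comp {U V W : Type} {G : NMGraph n m U} {H : NMGraph n m V} {K : NMGraph n m W}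
    {g : V → W} {f : U → V} (hg : IsHom H K g) (hf : IsHom G H f) : IsHom G K (g ∘ f) :=
  fun u v h => ⟨(hg _ _ (hf u v h).1).1, (hg _ _ (hf u v h).1).2.trans (hf u v h).2⟩

/-- Some vertex is simultaneously an `α`-neighbor of `u` and a `β`-neighbor of `v`. -/
def HasApex {V : Type} (G : NMGraph n m V) (u v : V) (α β : ℕ) : Prop :=
  ∃ w, w ∈ G.nbr α u ∧ w ∈ G.nbr β v

lemma IsHom.hasApex {V W : Type} {G : NMGraph n m V} {H : NMGraph n m W} {f : V → W}
    (hf : IsHom G H f) {u v : V} {α β : ℕ} (h : G.HasApex u v α β) :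
    H.HasApex (f u) (f v) α β := by
  obtain ⟨w, ⟨h₁, rfl⟩, h₂, rfl⟩ := h
  exact ⟨f w, hf _ _ h₁, hf _ _ h₂⟩

/-- A labelled 2-tree extends by a vertex joined with prescribed labels to the ends of an edge. -/
lemma exists_extension_hasApex {N : ℕ} (G : NMGraph n m (Fin N)) (hG : Is2Tree N G.und)
    {u v : Fin N} (huv : G.und.Adj u v) {α β : ℕ} (hα : 1 ≤ α ∧ α ≤ 2 * n + m)
    (hβ : 1 ≤ β ∧ β ≤ 2 * n + m) :
    ∃ G' : NMGraph n m (Fin (N + 1)), Is2Tree (N + 1) G'.und ∧ IsHom G G' Fin.castSucc ∧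
      G'.HasApex u.castSucc v.castSucc α β := by
  let γ : Fin N → ℕ := fun x => if x = u then α else β
  have hγ : ∀ x, 1 ≤ γ x ∧ γ x ≤ 2 * n + m := fun x => by
    by_cases h : x = u <;> simp only [γ, h, if_true, if_false] <;> assumption
  let l : Fin (N + 1) → Fin (N + 1) → ℕ :=
    Fin.lastCases (Fin.lastCases 0 fun b => conjLab n (γ b))
      fun a => Fin.lastCases (γ a) fun b => G.lab a b
  refine ⟨⟨addVertex G.und u v, l, ?_, ?_⟩, .extend u v huv hG, ?_, Fin.last N, ?_, ?_⟩
  · intro a b hab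
    induction a using Fin.lastCases with
    | last =>
      induction b using Fin.lastCases with
      | last => exact absurd hab (SimpleGraph.irrefl _)
      | cast b => simpa [l] using conjLab_mem (hγ b)
    | cast a =>
      induction b using Fin.lastCases with
      | last => simpa [l] using hγ a
      | cast b => simpa [l] using G.lab_mem a b (by simpa using hab)
  · intro a b hab
    induction a using Fin.lastCases with
    | last =>
      induction b using Fin.lastCases with
      | last => exact absurd hab (SimpleGraph.irrefl _)
      | cast b => simp [l, conjLab_conjLab (hγ b).1]
    | cast a =>
      induction b using Fin.lastCases with
      | last => simp [l]
      | cast b => simpa [l] using G.lab_conj a b (by simpa using hab)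
  · intro a b hab
    exact ⟨by simpa using hab, by simp [l]⟩
  · exact ⟨by simp, by simp [l, γ]⟩
  · exact ⟨by simp, by simp [l, γ, huv.ne']⟩

/-- A labelled 2-tree maps to one in which every edge of the former has all possible apexes. -/
lemma exists_hom_forall_hasApex {N : ℕ} (G : NMGraph n m (Fin N)) (hG : Is2Tree N G.und) :
    ∃ (M : ℕ) (K : NMGraph n m (Fin M)) (f : Fin N → Fin M), Is2Tree M K.und ∧ IsHom G K f ∧
      ∀ u v, G.und.Adj u v → ∀ α ∈ Finset.Icc 1 (2 * n + m), ∀ β ∈ Finset.Icc 1 (2 * n + m),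
        K.HasApex (f u) (f v) α β := by
  classical
  let I := Finset.Icc 1 (2 * n + m)
  suffices H : ∀ S ⊆ (Finset.univ : Finset (Fin N × Fin N)) ×ˢ (I ×ˢ I),
      ∃ (M : ℕ) (K : NMGraph n m (Fin M)) (f : Fin N → Fin M), Is2Tree M K.und ∧ IsHom G K f ∧
        ∀ t ∈ S, G.und.Adj t.1.1 t.1.2 → K.HasApex (f t.1.1) (f t.1.2) t.2.1 t.2.2 by
    obtain ⟨M, K, f, hK, hf, h⟩ := H _ subset_rfl
    exact ⟨M, K, f, hK, hf, fun u v huv α hα β hβ =>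
      h ((u, v), (α, β))
        (Finset.mem_product.2 ⟨Finset.mem_univ _, Finset.mem_product.2 ⟨hα, hβ⟩⟩) huv⟩
  intro S
  induction S using Finset.induction_on with
  | empty => exact fun _ => ⟨N, G, id, hG, fun u v h => ⟨h, rfl⟩, by simp⟩
  | insert t S _ ih =>
    intro hS
    obtain ⟨ht, hS⟩ := Finset.insert_subset_iff.1 hS
    obtain ⟨M, K, f, hK, hf, h⟩ := ih hS
    by_cases huv : G.und.Adj t.1.1 t.1.2
    · simp only [Finset.mem_product, I, Finset.mem_Icc] at ht
      obtain ⟨K', hK', hf', h'⟩ := K.exists_extension_hasApex hK (hf _ _ huv).1 ht.2.1 ht.2.2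
      refine ⟨M + 1, K', Fin.castSucc ∘ f, hK', hf'.comp hf, ?_⟩
      rintro s hs hst
      rcases Finset.mem_insert.1 hs with rfl | hs
      · exact h'
      · exact hf'.hasApex (h s hs hst)
    · refine ⟨M, K, f, hK, hf, ?_⟩
      rintro s hs hst
      rcases Finset.mem_insert.1 hs with rfl | hs
      · exact absurd hst huv
      · exact h s hs hst

/-- Labels pull along an embedding into a larger graph, provided there is at least one label. -/
lemma exists_extend_lab (hp : 1 ≤ 2 * n + m) {V : Type} {N : ℕ} (G : NMGraph n m V)
    (K : SimpleGraph (Fin N)) (f : G.und →g K) (hf : Function.Injective f) :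
    ∃ K' : NMGraph n m (Fin N), K'.und = K ∧ IsHom G K' f := by
  classical
  have key : ∀ a b, ∃ l, (∀ x y, f x = a → f y = b → G.und.Adj x y → l = G.lab x y) ∧
      ((¬ ∃ x y, f x = a ∧ f y = b ∧ G.und.Adj x y) → l = if a < b then 1 else conjLab n 1) := by
    intro a b
    by_cases h : ∃ x y, f x = a ∧ f y = b ∧ G.und.Adj x y
    · obtain ⟨x, y, rfl, rfl, hxy⟩ := h
      refine ⟨G.lab x y, fun x' y' hx hy _ => by rw [hf hx, hf hy], fun h => ?_⟩
      exact absurd ⟨x, y, rfl, rfl, hxy⟩ h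
    · exact ⟨_, fun x y hx hy hxy => absurd ⟨x, y, hx, hy, hxy⟩ h, fun _ => rfl⟩
  choose l hl hl' using key
  refine ⟨⟨K, l, ?_, ?_⟩, rfl, fun x y h => ⟨f.map_adj h, hl _ _ x y rfl rfl h⟩⟩
  · intro a b _
    by_cases h : ∃ x y, f x = a ∧ f y = b ∧ G.und.Adj x y
    · obtain ⟨x, y, hx, hy, hxy⟩ := h
      rw [hl a b x y hx hy hxy]
      exact G.lab_mem x y hxy
    · rw [hl' a b h]
      split_ifs
      exacts [⟨le_rfl, hp⟩, conjLab_mem ⟨le_rfl, hp⟩]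
  · intro a b hab
    by_cases h : ∃ x y, f x = a ∧ f y = b ∧ G.und.Adj x y
    · obtain ⟨x, y, hx, hy, hxy⟩ := h
      rw [hl a b x y hx hy hxy, hl b a y x hy hx hxy.symm]
      exact G.lab_conj x y hxy
    · have h' : ¬ ∃ x y, f x = b ∧ f y = a ∧ G.und.Adj x y :=
        fun ⟨x, y, hx, hy, hxy⟩ => h ⟨y, x, hy, hx, hxy.symm⟩
      rw [hl' a b h, hl' b a h']
      rcases hab.ne.lt_or_gt with hlt | hlt
      · rw [if_pos hlt, if_neg hlt.not_gt]
      · rw [if_pos hlt, if_neg hlt.not_gt, conjLab_conjLab le_rfl]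

/-- The edges of `T` over which every pair of labels is realised by a common neighbor. -/
def apexGraph {W : Type} (T : NMGraph n m W) : SimpleGraph W where
  Adj u v := T.und.Adj u v ∧ ∀ α ∈ Finset.Icc 1 (2 * n + m), ∀ β ∈ Finset.Icc 1 (2 * n + m),
    T.HasApex u v α β
  symm := ⟨fun _ _ h => ⟨h.1.symm, fun α hα β hβ =>
    (h.2 β hβ α hα).imp fun _ => And.symm⟩⟩
  loopless := ⟨fun _ h => h.1.ne rfl⟩

lemma apexGraph_le {W : Type} (T : NMGraph n m W) : T.apexGraph ≤ T.und :=
  fun _ _ h => h.1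

end NMGraph

section

open NMGraph

variable {n m : ℕ}

/-- A universal bound stays one after keeping only the edges with all apexes and their ends. -/
lemma IsUnivBoundT2.restrict_apexGraph (hp : 1 ≤ 2 * n + m) {W : Type} {T : NMGraph n m W}
    (hT : IsUnivBoundT2 n m T) :
    IsUnivBoundT2 n m (T.restrict {u | ∃ v, T.apexGraph.Adj u v} T.apexGraph T.apexGraph_le) := by
  rintro N G ⟨M, K, f, hK, hf⟩
  obtain ⟨K, rfl, hfK⟩ := G.exists_extend_lab hp K f hf
  obtain ⟨M', K', g, hK', hg, hapex⟩ := K.exists_hom_forall_hasApex hK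
  obtain ⟨h, hh⟩ : ∃ h, IsHom K' T h := hT M' K' hK'.isPartial2Tree
  have hadj : ∀ a b, K.und.Adj a b → T.apexGraph.Adj (h (g a)) (h (g b)) := fun a b hab =>
    ⟨((hh.comp hg) a b hab).1, fun α hα β hβ => hh.hasApex (hapex a b hab α hα β hβ)⟩
  refine ⟨fun x => ⟨h (g (f x)), ?_⟩, fun x y hxy => ⟨hadj _ _ (hfK x y hxy).1, ?_⟩⟩
  · obtain ⟨b, hb⟩ := hK.exists_adj (f x)
    exact ⟨_, hadj _ _ hb⟩
  · exact (((hh.comp hg).comp hfK) x y hxy).2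

lemma IsMinUnivBoundT2.apexGraph_eq (hp : 1 ≤ 2 * n + m) {W : Type} {T : NMGraph n m W}
    (hT : IsMinUnivBoundT2 n m T) :
    (∀ u, ∃ v, T.und.Adj u v) ∧ T.apexGraph = T.und := by
  have h := not_or.1 fun h => hT.2 _ _ _ h (hT.1.restrict_apexGraph hp)
  rw [not_ne_iff, not_ne_iff] at h
  refine ⟨fun u => ?_, h.2⟩
  obtain ⟨v, hv⟩ : u ∈ {u | ∃ v, T.apexGraph.Adj u v} := h.1 ▸ Set.mem_univ u
  exact ⟨v, hv.1⟩

lemma IsMinUnivBoundT2.le_ncard_nbr {W : Type} [Finite W] {T : NMGraph n m W}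
    (hT : IsMinUnivBoundT2 n m T) {α : ℕ} (hα : α ∈ Finset.Icc 1 (2 * n + m)) (u : W) :
    2 * n + m + 1 ≤ (T.nbr α u).ncard := by
  classical
  obtain ⟨hne, heq⟩ := hT.apexGraph_eq (by grind)
  have hapex : ∀ {x y}, T.und.Adj x y → ∀ γ ∈ Finset.Icc 1 (2 * n + m),
      ∀ β ∈ Finset.Icc 1 (2 * n + m), T.HasApex x y γ β := fun {x y} hxy =>
    (show T.apexGraph.Adj x y from heq ▸ hxy).2
  obtain ⟨x, hx⟩ := hne u
  obtain ⟨v, hv, -⟩ := hapex hx α hα α hα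
  have : Nonempty W := ⟨u⟩
  choose! w hwu hwv using fun β hβ => hapex hv.1 α hα β hβ
  have hinj : Set.InjOn w (Finset.Icc 1 (2 * n + m)) := fun β hβ γ hγ h => by
    rw [← (hwv β hβ).2, ← (hwv γ hγ).2, h]
  have hv' : v ∉ (Finset.Icc 1 (2 * n + m)).image w := fun h => by
    obtain ⟨β, hβ, rfl⟩ := Finset.mem_image.1 h
    exact (hwv β hβ).1.ne rfl
  calc 2 * n + m + 1 = (insert v ((Finset.Icc 1 (2 * n + m)).image w)).card := by
        rw [Finset.card_insert_of_notMem hv', Finset.card_image_of_injOn hinj]; simp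
    _ = ((insert v ((Finset.Icc 1 (2 * n + m)).image w) : Finset W) : Set W).ncard :=
        (Set.ncard_coe_finset _).symm
    _ ≤ _ := Set.ncard_le_ncard (by
        intro y hy
        rcases Finset.mem_insert.1 hy with rfl | hy
        · exact hv
        · obtain ⟨β, hβ, rfl⟩ := Finset.mem_image.1 hy
          exact hwu β hβ) (Set.toFinite _)

end

/-- A minimal `(n,m)`-universal bound of the partial 2-trees on exactly
`(2n+m)² + (2n+m) + 1` vertices has exactly `(2n+m)+1` many `α`-neighbors at every
vertex, for every type `α`; in particular its underlying graph is complete. -/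
theorem minUnivBoundT2_regular (n m : ℕ) (hnm : (n, m) ≠ (0, 1))
    {W : Type} [Fintype W] (T : NMGraph n m W)
    (hT : IsMinUnivBoundT2 n m T)
    (hcard : Fintype.card W = (2 * n + m) ^ 2 + (2 * n + m) + 1) :
    (∀ α : ℕ, 1 ≤ α → α ≤ 2 * n + m → ∀ u, (T.nbr α u).ncard = (2 * n + m) + 1) ∧
      T.und = ⊤ := by
  classical
  let I := Finset.Icc 1 (2 * n + m)
  let F : W → ℕ → Finset W := fun u α => (T.nbr α u).toFinset
  have hF : ∀ u α, (F u α).card = (T.nbr α u).ncard := fun u α =>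
    (Set.ncard_eq_toFinset_card' _).symm
  have hsub : ∀ u, I.biUnion (F u) ⊆ Finset.univ.erase u := fun u v hv => by
    obtain ⟨α, -, hv⟩ := Finset.mem_biUnion.1 hv
    exact Finset.mem_erase.2 ⟨(Set.mem_toFinset.1 hv).1.ne', Finset.mem_univ v⟩
  have hdisj : ∀ u, (I.biUnion (F u)).card = ∑ α ∈ I, (F u α).card := fun u =>
    Finset.card_biUnion fun α _ β _ hne => Finset.disjoint_left.2 fun v hv hv' =>
      hne ((Set.mem_toFinset.1 hv).2.symm.trans (Set.mem_toFinset.1 hv').2)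
  have hconst : ∑ _α ∈ I, (2 * n + m + 1) = (2 * n + m) ^ 2 + (2 * n + m) := by
    simp only [I, Finset.sum_const, Nat.card_Icc, smul_eq_mul, Nat.add_sub_cancel]
    ring
  have herase : ∀ u : W, (Finset.univ.erase u).card = (2 * n + m) ^ 2 + (2 * n + m) := fun u => by
    rw [Finset.card_erase_of_mem (Finset.mem_univ u), Finset.card_univ, hcard,
      Nat.add_sub_cancel]
  have hle : ∀ u, ∀ α ∈ I, 2 * n + m + 1 ≤ (F u α).card := fun u α hα =>
    (hT.le_ncard_nbr hα u).trans (hF u α).ge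
  have hsum : ∀ u, ∑ _α ∈ I, (2 * n + m + 1) = ∑ α ∈ I, (F u α).card := fun u =>
    (Finset.sum_le_sum (hle u)).antisymm <| by
      rw [hconst, ← herase u, ← hdisj]
      exact Finset.card_le_card (hsub u)
  refine ⟨fun α h₁ h₂ u => ?_, ?_⟩
  · rw [← hF]
    exact ((Finset.sum_eq_sum_iff_of_le (hle u)).1 (hsum u) α (Finset.mem_Icc.2 ⟨h₁, h₂⟩)).symm
  · refine eq_top_iff.2 fun u v huv => ?_
    have heq : I.biUnion (F u) = Finset.univ.erase u :=
      Finset.eq_of_subset_of_card_le (hsub u) (by rw [herase, hdisj, ← hsum, hconst])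
    have hv : v ∈ I.biUnion (F u) := heq ▸ Finset.mem_erase.2 ⟨huv.ne', Finset.mem_univ v⟩
    obtain ⟨α, -, hv⟩ := Finset.mem_biUnion.1 hv
    exact (Set.mem_toFinset.1 hv).1
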